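/- arXiv:1503.00694 — 2 statements merged into one kernel-verified Lean document; each statement's English description precedes it below -/
import Mathlib

section
/- Let M ∈ ℚ^{n×n} be a skew-symmetric matrix. Then there exist a preference profile R on [n] = {1,…,n} and a positive rational c such that c·M = M_R. Furthermore, R can be chosen so that for every permutation π of [n] with M(i,j) = M(π(i),π(j)) for all i,j ∈ [n], it holds that π(R) = R. -/
open Finset

namespace PSC

/-- `r` is a linear order (complete, transitive, antisymmetric; as a set of pairs) on `A`. -/
def IsLinearOrderOn (A : Finset ℕ) (r : Finset (ℕ × ℕ)) : Prop :=
  r ⊆ A ×ˢ A ∧ (∀ x ∈ A, (x, x) ∈ r) ∧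
    (∀ x ∈ A, ∀ y ∈ A, (x, y) ∈ r ∨ (y, x) ∈ r) ∧
    (∀ x y z : ℕ, (x, y) ∈ r → (y, z) ∈ r → (x, z) ∈ r) ∧
    (∀ x y : ℕ, (x, y) ∈ r → (y, x) ∈ r → x = y)

open Classical in
/-- The set `L(A)` of linear orders on the agenda `A`. -/
noncomputable def linOrders (A : Finset ℕ) : Finset (Finset (ℕ × ℕ)) :=
  (A ×ˢ A).powerset.filter (fun r => IsLinearOrderOn A r)

/-- `R` is a (fractional) preference profile on the agenda `A`. -/
def IsProfile (A : Finset ℕ) (R : Finset (ℕ × ℕ) → ℚ) : Prop :=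
  (∀ r, r ∉ linOrders A → R r = 0) ∧ (∀ r, 0 ≤ R r) ∧ (∑ r ∈ linOrders A, R r) = 1

open Classical in
/-- `R(x,y)`: the total weight of orders ranking `x` strictly above `y`. -/
noncomputable def pref (A : Finset ℕ) (R : Finset (ℕ × ℕ) → ℚ) (x y : ℕ) : ℚ :=
  ∑ r ∈ (linOrders A).filter (fun r => (x, y) ∈ r ∧ (y, x) ∉ r), R r

/-- The majority margin `M_R(x,y) = R(x,y) - R(y,x)`. -/
noncomputable def margin (A : Finset ℕ) (R : Finset (ℕ × ℕ) → ℚ) (x y : ℕ) : ℚ :=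
  pref A R x y - pref A R y x

/-- `p` is a lottery on `A`. -/
def IsLottery (A : Finset ℕ) (p : ℕ → ℚ) : Prop :=
  (∀ x, x ∉ A → p x = 0) ∧ (∀ x, 0 ≤ p x) ∧ (∑ x ∈ A, p x) = 1

/-- `Δ(A)`, the set of lotteries on `A`. -/
def lotteries (A : Finset ℕ) : Set (ℕ → ℚ) := {p | IsLottery A p}

/-- 1-norm distance between two profiles on `A`. -/
noncomputable def profileDist (A : Finset ℕ) (R R' : Finset (ℕ × ℕ) → ℚ) : ℚ :=
  ∑ r ∈ linOrders A, |R r - R' r|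

/-- 1-norm distance between two lotteries on `A`. -/
noncomputable def lotteryDist (A : Finset ℕ) (p q : ℕ → ℚ) : ℚ :=
  ∑ x ∈ A, |p x - q x|

/-- Restriction of an order to `B`. -/
def restrictOrder (B : Finset ℕ) (r : Finset (ℕ × ℕ)) : Finset (ℕ × ℕ) := r ∩ B ×ˢ B

open Classical in
/-- The restriction `R|_B` of a profile on `A` to `B`. -/
noncomputable def restrictProfile (A B : Finset ℕ) (R : Finset (ℕ × ℕ) → ℚ) :
    Finset (ℕ × ℕ) → ℚ :=
  fun s => ∑ r ∈ (linOrders A).filter (fun r => restrictOrder B r = s), R r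

/-- `B` is a component in the profile `R` on `A`. -/
def IsComponent (A B : Finset ℕ) (R : Finset (ℕ × ℕ) → ℚ) : Prop :=
  B ⊆ A ∧ ∀ a ∈ A \ B, ∀ b ∈ B, ∀ b' ∈ B, ∀ r ∈ linOrders A, 0 < R r →
    ((a, b) ∈ r ↔ (a, b') ∈ r)

/-- The composed lottery `p ×_b q` (where `B` is the component). -/
def compLottery (B : Finset ℕ) (b : ℕ) (p q : ℕ → ℚ) : ℕ → ℚ :=
  fun x => if x ∈ B then p b * q x else p x

/-- `X ×_b Y` for sets of lotteries. -/
def compSet (B : Finset ℕ) (b : ℕ) (X Y : Set (ℕ → ℚ)) : Set (ℕ → ℚ) :=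
  {pr | ∃ p ∈ X, ∃ q ∈ Y, pr = compLottery B b p q}

/-- A probabilistic social choice function: to every (finite nonempty) agenda `A ⊆ ℕ` and
every profile on `A` it assigns a nonempty convex set of lotteries on `A`; it is upper
hemi-continuous and satisfies unanimity and decisiveness. -/
structure PSCF where
  choice : Finset ℕ → (Finset (ℕ × ℕ) → ℚ) → Set (ℕ → ℚ)
  nonempty : ∀ A : Finset ℕ, A.Nonempty → ∀ R, IsProfile A R → (choice A R).Nonempty
  subset_lotteries : ∀ A : Finset ℕ, A.Nonempty → ∀ R, IsProfile A R →
    choice A R ⊆ lotteries A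
  convex : ∀ A : Finset ℕ, A.Nonempty → ∀ R, IsProfile A R →
    ∀ p ∈ choice A R, ∀ q ∈ choice A R, ∀ t : ℚ, 0 ≤ t → t ≤ 1 →
      (fun x => t * p x + (1 - t) * q x) ∈ choice A R
  continuity : ∀ A : Finset ℕ, A.Nonempty → ∀ R, IsProfile A R → ∀ ε : ℚ, 0 < ε →
    ∃ δ : ℚ, 0 < δ ∧ ∀ R', IsProfile A R' → profileDist A R R' < δ →
      ∀ p ∈ choice A R', ∃ q ∈ choice A R, lotteryDist A p q < ε
  unanimity : ∀ x y : ℕ, ∀ R, IsProfile {x, y} R → pref {x, y} R x y = 1 →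
    choice {x, y} R = {fun z => if z = x then 1 else 0}
  decisive : ∀ A : Finset ℕ, A.Nonempty → ∀ R, IsProfile A R → ∀ ε : ℚ, 0 < ε →
    ∃ R', IsProfile A R' ∧ profileDist A R R' < ε ∧ ∃ p, choice A R' = {p}

/-- Population-consistency. -/
def PopulationConsistent (f : PSCF) : Prop :=
  ∀ A : Finset ℕ, A.Nonempty → ∀ R' R'', IsProfile A R' → IsProfile A R'' →
    ∀ l : ℚ, 0 ≤ l → l ≤ 1 →
      f.choice A R' ∩ f.choice A R'' ⊆ f.choice A (fun r => l * R' r + (1 - l) * R'' r)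

/-- Composition-consistency. -/
def CompositionConsistent (f : PSCF) : Prop :=
  ∀ A' B : Finset ℕ, ∀ b : ℕ, A' ∩ B = {b} →
    ∀ R, IsProfile (A' ∪ B) R → IsComponent (A' ∪ B) B R →
      f.choice (A' ∪ B) R =
        compSet B b (f.choice A' (restrictProfile (A' ∪ B) A' R))
          (f.choice B (restrictProfile (A' ∪ B) B R))

/-- The maximal-lotteries correspondence. -/
noncomputable def ML (A : Finset ℕ) (R : Finset (ℕ × ℕ) → ℚ) : Set (ℕ → ℚ) :=
  {p | IsLottery A p ∧ ∀ q, IsLottery A q →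
    0 ≤ ∑ x ∈ A, ∑ y ∈ A, p x * margin A R x y * q y}

/-- The uniform profile `uni(L(A))` on `A`. -/
noncomputable def uniProfile (A : Finset ℕ) : Finset (ℕ × ℕ) → ℚ :=
  fun r => if r ∈ linOrders A then ((Nat.factorial A.card : ℕ) : ℚ)⁻¹ else 0

/-- The uniform lottery `uni(A)` on `A`. -/
def uniLottery (A : Finset ℕ) : ℕ → ℚ :=
  fun x => if x ∈ A then (A.card : ℚ)⁻¹ else 0

/-- The degenerate lottery on `x`. -/
def degLottery (x : ℕ) : ℕ → ℚ := fun z => if z = x then 1 else 0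

/-- `x` is a (weak) Condorcet winner in `R`. -/
def IsCondorcetWinner (A : Finset ℕ) (R : Finset (ℕ × ℕ) → ℚ) (x : ℕ) : Prop :=
  x ∈ A ∧ ∀ y ∈ A, 0 ≤ margin A R x y

/-- `R` is regular on `A'`. -/
def Regular (A A' : Finset ℕ) (R : Finset (ℕ × ℕ) → ℚ) : Prop :=
  ∀ x ∈ A', (∑ y ∈ A', margin A R x y) = 0

/-- `R` is strongly regular on `A'`. -/
def StronglyRegular (A A' : Finset ℕ) (R : Finset (ℕ × ℕ) → ℚ) : Prop :=
  ∀ x ∈ A', ∀ y ∈ A', margin A R x y = 0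

/-- Image of an order under a renaming `π`. -/
def mapOrder (π : ℕ → ℕ) (r : Finset (ℕ × ℕ)) : Finset (ℕ × ℕ) :=
  r.image (fun xy => (π xy.1, π xy.2))

open Classical in
/-- The image `π(R)` of a profile on `A` under a renaming `π`. -/
noncomputable def mapProfile (π : ℕ → ℕ) (A : Finset ℕ) (R : Finset (ℕ × ℕ) → ℚ) :
    Finset (ℕ × ℕ) → ℚ :=
  fun s => ∑ r ∈ (linOrders A).filter (fun r => mapOrder π r = s), R r

open Classical in
/-- The image `π(p)` of a lottery on `A` under a renaming `π`. -/
noncomputable def mapLottery (π : ℕ → ℕ) (A : Finset ℕ) (p : ℕ → ℚ) : ℕ → ℚ :=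
  fun y => ∑ x ∈ A.filter (fun x => π x = y), p x

/-- The bound `ε_n = (4^n · ∏_{k=1}^n k!)⁻¹`. -/
noncomputable def epsN (n : ℕ) : ℚ :=
  (((4 ^ n * ∏ k ∈ Finset.Icc 1 n, Nat.factorial k : ℕ) : ℚ))⁻¹

section Aux

lemma mem_linOrders {A : Finset ℕ} {r : Finset (ℕ × ℕ)} :
    r ∈ linOrders A ↔ IsLinearOrderOn A r := by
  unfold linOrders
  simp only [Finset.mem_filter, Finset.mem_powerset]
  exact ⟨fun h => h.2, fun h => ⟨h.1, h⟩⟩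

lemma mem_mapOrder {A : Finset ℕ} {π : ℕ → ℕ} (hπ : Set.BijOn π (A : Set ℕ) (A : Set ℕ))
    {r : Finset (ℕ × ℕ)} (hr : r ⊆ A ×ˢ A) {x y : ℕ} (hx : x ∈ A) (hy : y ∈ A) :
    (π x, π y) ∈ mapOrder π r ↔ (x, y) ∈ r := by
  unfold mapOrder
  constructor
  · intro h
    obtain ⟨⟨u, v⟩, huv, he⟩ := Finset.mem_image.1 h
    have hm := Finset.mem_product.1 (hr huv)
    simp only [Prod.mk.injEq] at he
    have h1 : u = x := hπ.injOn (by exact_mod_cast hm.1) (by exact_mod_cast hx) he.1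
    have h2 : v = y := hπ.injOn (by exact_mod_cast hm.2) (by exact_mod_cast hy) he.2
    subst h1; subst h2; exact huv
  · intro h
    exact Finset.mem_image.2 ⟨(x, y), h, rfl⟩

lemma bij_surj {A : Finset ℕ} {π : ℕ → ℕ} (hπ : Set.BijOn π (A : Set ℕ) (A : Set ℕ))
    {z : ℕ} (hz : z ∈ A) : ∃ w ∈ A, π w = z := by
  obtain ⟨w, hw, e⟩ := hπ.surjOn (by exact_mod_cast hz : z ∈ (A : Set ℕ))
  exact ⟨w, by exact_mod_cast hw, e⟩

lemma bij_mem {A : Finset ℕ} {π : ℕ → ℕ} (hπ : Set.BijOn π (A : Set ℕ) (A : Set ℕ))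
    {z : ℕ} (hz : z ∈ A) : π z ∈ A := by
  have := hπ.mapsTo (by exact_mod_cast hz : z ∈ (A : Set ℕ))
  exact_mod_cast this

lemma bij_inj {A : Finset ℕ} {π : ℕ → ℕ} (hπ : Set.BijOn π (A : Set ℕ) (A : Set ℕ))
    {z w : ℕ} (hz : z ∈ A) (hw : w ∈ A) : π z = π w ↔ z = w :=
  ⟨fun h => hπ.injOn (by exact_mod_cast hz) (by exact_mod_cast hw) h, fun h => by rw [h]⟩

lemma mapOrder_mem {A : Finset ℕ} {π : ℕ → ℕ} (hπ : Set.BijOn π (A : Set ℕ) (A : Set ℕ))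
    {r : Finset (ℕ × ℕ)} (hr : r ∈ linOrders A) : mapOrder π r ∈ linOrders A := by
  rw [mem_linOrders] at hr ⊢
  obtain ⟨h1, h2, h3, h4, h5⟩ := hr
  have hs : mapOrder π r ⊆ A ×ˢ A := by
    intro p hp
    obtain ⟨⟨u, v⟩, huv, he⟩ := Finset.mem_image.1 hp
    have hm := Finset.mem_product.1 (h1 huv)
    subst he
    exact Finset.mem_product.2 ⟨bij_mem hπ hm.1, bij_mem hπ hm.2⟩
  have hA : ∀ {x y}, (x, y) ∈ mapOrder π r → x ∈ A ∧ y ∈ A :=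
    fun h => Finset.mem_product.1 (hs h)
  refine ⟨hs, ?_, ?_, ?_, ?_⟩
  · intro x hx
    obtain ⟨u, hu, rfl⟩ := bij_surj hπ hx
    exact (mem_mapOrder hπ h1 hu hu).2 (h2 u hu)
  · intro x hx y hy
    obtain ⟨u, hu, rfl⟩ := bij_surj hπ hx
    obtain ⟨v, hv, rfl⟩ := bij_surj hπ hy
    rw [mem_mapOrder hπ h1 hu hv, mem_mapOrder hπ h1 hv hu]
    exact h3 u hu v hv
  · intro x y z hxy hyz
    obtain ⟨u, hu, rfl⟩ := bij_surj hπ (hA hxy).1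
    obtain ⟨v, hv, rfl⟩ := bij_surj hπ (hA hxy).2
    obtain ⟨w, hw, rfl⟩ := bij_surj hπ (hA hyz).2
    rw [mem_mapOrder hπ h1 hu hv] at hxy
    rw [mem_mapOrder hπ h1 hv hw] at hyz
    rw [mem_mapOrder hπ h1 hu hw]
    exact h4 _ _ _ hxy hyz
  · intro x y hxy hyx
    obtain ⟨u, hu, rfl⟩ := bij_surj hπ (hA hxy).1
    obtain ⟨v, hv, rfl⟩ := bij_surj hπ (hA hxy).2
    rw [mem_mapOrder hπ h1 hu hv] at hxy
    rw [mem_mapOrder hπ h1 hv hu] at hyx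
    rw [h5 _ _ hxy hyx]

lemma mapOrder_injOn {A : Finset ℕ} {π : ℕ → ℕ} (hπ : Set.BijOn π (A : Set ℕ) (A : Set ℕ)) :
    Set.InjOn (mapOrder π) (linOrders A : Set (Finset (ℕ × ℕ))) := by
  intro r hr s hs h
  have hr' := (mem_linOrders.1 (Finset.mem_coe.1 hr)).1
  have hs' := (mem_linOrders.1 (Finset.mem_coe.1 hs)).1
  ext ⟨x, y⟩
  by_cases hxy : x ∈ A ∧ y ∈ A
  · rw [← mem_mapOrder hπ hr' hxy.1 hxy.2, ← mem_mapOrder hπ hs' hxy.1 hxy.2, h]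
  · exact ⟨fun h => absurd (Finset.mem_product.1 (hr' h)) hxy,
      fun h => absurd (Finset.mem_product.1 (hs' h)) hxy⟩

lemma sum_mapOrder {A : Finset ℕ} {π : ℕ → ℕ} (hπ : Set.BijOn π (A : Set ℕ) (A : Set ℕ))
    (F : Finset (ℕ × ℕ) → ℚ) :
    ∑ r ∈ linOrders A, F (mapOrder π r) = ∑ r ∈ linOrders A, F r := by
  have hm : Set.MapsTo (mapOrder π) (linOrders A : Set (Finset (ℕ × ℕ)))
      (linOrders A : Set (Finset (ℕ × ℕ))) := fun r hr =>
    Finset.mem_coe.2 (mapOrder_mem hπ (Finset.mem_coe.1 hr))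
  exact Finset.sum_nbij (mapOrder π) (fun r hr => mapOrder_mem hπ hr) (mapOrder_injOn hπ)
    (Finset.surjOn_of_injOn_of_card_le _ hm (mapOrder_injOn hπ) le_rfl) (fun _ _ => rfl)

/-- `a` and `b` are the top two alternatives of `r`, in this order. -/
def Top (A : Finset ℕ) (r : Finset (ℕ × ℕ)) (a b : ℕ) : Prop :=
  a ≠ b ∧ (a, b) ∈ r ∧ ∀ z ∈ A, z ≠ a → z ≠ b → (b, z) ∈ r

lemma top_mapOrder {A : Finset ℕ} {π : ℕ → ℕ} (hπ : Set.BijOn π (A : Set ℕ) (A : Set ℕ))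
    {r : Finset (ℕ × ℕ)} (hr : r ⊆ A ×ˢ A) {a b : ℕ} (ha : a ∈ A) (hb : b ∈ A) :
    Top A (mapOrder π r) (π a) (π b) ↔ Top A r a b := by
  unfold Top
  rw [mem_mapOrder hπ hr ha hb, Ne, bij_inj hπ ha hb]
  refine and_congr_right fun _ => and_congr_right fun _ => ?_
  constructor
  · intro h z hz h1 h2
    rw [← mem_mapOrder hπ hr hb hz]
    exact h _ (bij_mem hπ hz) (by rwa [Ne, bij_inj hπ hz ha]) (by rwa [Ne, bij_inj hπ hz hb])
  · intro h z hz h1 h2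
    obtain ⟨w, hw, rfl⟩ := bij_surj hπ hz
    rw [mem_mapOrder hπ hr hb hw]
    rw [Ne, bij_inj hπ hw ha] at h1
    rw [Ne, bij_inj hπ hw hb] at h2
    exact h w hw h1 h2

open Classical in
noncomputable def sgn (r : Finset (ℕ × ℕ)) (x y : ℕ) : ℚ :=
  (if (x, y) ∈ r ∧ (y, x) ∉ r then 1 else 0) - (if (y, x) ∈ r ∧ (x, y) ∉ r then 1 else 0)

lemma sgn_swap (r : Finset (ℕ × ℕ)) (x y : ℕ) : sgn r y x = - sgn r x y := by
  unfold sgn; ring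

lemma sgn_mapOrder {A : Finset ℕ} {π : ℕ → ℕ} (hπ : Set.BijOn π (A : Set ℕ) (A : Set ℕ))
    {r : Finset (ℕ × ℕ)} (hr : r ⊆ A ×ˢ A) {a b : ℕ} (ha : a ∈ A) (hb : b ∈ A) :
    sgn (mapOrder π r) (π a) (π b) = sgn r a b := by
  unfold sgn
  simp only [mem_mapOrder hπ hr ha hb, mem_mapOrder hπ hr hb ha]

lemma sgn_one {A : Finset ℕ} {r : Finset (ℕ × ℕ)} (hr : r ∈ linOrders A) {x y : ℕ}
    (h : (x, y) ∈ r) (hne : x ≠ y) : sgn r x y = 1 := by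
  have h5 := (mem_linOrders.1 hr).2.2.2.2
  have : (y, x) ∉ r := fun h' => hne (h5 _ _ h h')
  unfold sgn
  simp [h, this]

lemma margin_eq (A : Finset ℕ) (R : Finset (ℕ × ℕ) → ℚ) (x y : ℕ) :
    margin A R x y = ∑ r ∈ linOrders A, R r * sgn r x y := by
  unfold margin pref sgn
  rw [Finset.sum_filter, Finset.sum_filter, ← Finset.sum_sub_distrib]
  refine Finset.sum_congr rfl fun r _ => ?_
  rw [mul_sub, mul_ite, mul_ite]
  simp

open Classical in
noncomputable def tp (A : Finset ℕ) (r : Finset (ℕ × ℕ)) (a b : ℕ) : ℚ :=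
  if Top A r a b then 1 else 0

lemma tp_mapOrder {A : Finset ℕ} {π : ℕ → ℕ} (hπ : Set.BijOn π (A : Set ℕ) (A : Set ℕ))
    {r : Finset (ℕ × ℕ)} (hr : r ∈ linOrders A) {a b : ℕ} (ha : a ∈ A) (hb : b ∈ A) :
    tp A (mapOrder π r) (π a) (π b) = tp A r a b := by
  unfold tp
  rw [top_mapOrder hπ (mem_linOrders.1 hr).1 ha hb]

/-- Number of orders with top two `a`, `b`. -/
noncomputable def cnt (A : Finset ℕ) (a b : ℕ) : ℚ := ∑ r ∈ linOrders A, tp A r a b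

lemma cnt_map {A : Finset ℕ} {π : ℕ → ℕ} (hπ : Set.BijOn π (A : Set ℕ) (A : Set ℕ))
    {a b : ℕ} (ha : a ∈ A) (hb : b ∈ A) : cnt A (π a) (π b) = cnt A a b := by
  unfold cnt
  rw [← sum_mapOrder hπ]
  exact Finset.sum_congr rfl fun r hr => tp_mapOrder hπ hr ha hb

lemma swap_bij {A : Finset ℕ} {a b : ℕ} (ha : a ∈ A) (hb : b ∈ A) :
    Set.BijOn (Equiv.swap a b) (A : Set ℕ) (A : Set ℕ) := by
  have hm : Set.MapsTo (Equiv.swap a b) (A : Set ℕ) (A : Set ℕ) := by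
    intro z hz
    rw [Equiv.swap_apply_def]
    split_ifs
    · exact_mod_cast hb
    · exact_mod_cast ha
    · exact hz
  refine ⟨hm, (Equiv.injective _).injOn, ?_⟩
  intro z hz
  exact ⟨Equiv.swap a b z, hm hz, Equiv.swap_apply_self _ _ _⟩

lemma cnt_symm {A : Finset ℕ} {a b : ℕ} (ha : a ∈ A) (hb : b ∈ A) :
    cnt A b a = cnt A a b := by
  have := cnt_map (swap_bij ha hb) ha hb
  rwa [Equiv.swap_apply_left, Equiv.swap_apply_right] at this

lemma order_of_key (A : Finset ℕ) (f : ℕ → ℕ) (hf : Function.Injective f) :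
    (A ×ˢ A).filter (fun p => f p.1 ≤ f p.2) ∈ linOrders A := by
  rw [mem_linOrders]
  refine ⟨Finset.filter_subset _ _, ?_, ?_, ?_, ?_⟩
  · intro x hx; simp [hx]
  · intro x hx y hy; simp [hx, hy, le_total]
  · intro x y z h1 h2
    simp only [Finset.mem_filter, Finset.mem_product] at *
    exact ⟨⟨h1.1.1, h2.1.2⟩, h1.2.trans h2.2⟩
  · intro x y h1 h2
    simp only [Finset.mem_filter, Finset.mem_product] at *
    exact hf (le_antisymm h1.2 h2.2)

lemma cnt_pos {A : Finset ℕ} {a b : ℕ} (ha : a ∈ A) (hb : b ∈ A) (hab : a ≠ b) :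
    0 < cnt A a b := by
  let f : ℕ → ℕ := fun z => if z = a then 0 else if z = b then 1 else z + 2
  have hf : Function.Injective f := by
    intro x y h
    simp only [f] at h
    split_ifs at h <;> omega
  have hm := order_of_key A f hf
  unfold cnt
  refine Finset.sum_pos' (fun r _ => by unfold tp; split_ifs <;> norm_num) ⟨_, hm, ?_⟩
  have : Top A ((A ×ˢ A).filter (fun p => f p.1 ≤ f p.2)) a b := by
    refine ⟨hab, ?_, ?_⟩
    · simp [ha, hb, f]
    · intro z hz h1 h2
      simp [hb, hz, f, h1, h2, hab.symm]
  unfold tp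
  rw [if_pos this]; norm_num

noncomputable def gg (A : Finset ℕ) (a b x y : ℕ) : ℚ :=
  ∑ r ∈ linOrders A, tp A r a b * sgn r x y

lemma gg_self {A : Finset ℕ} (x y : ℕ) : gg A x y x y = cnt A x y := by
  unfold gg cnt
  refine Finset.sum_congr rfl fun r hr => ?_
  unfold tp
  split_ifs with h
  · rw [sgn_one hr h.2.1 h.1]; ring
  · ring

lemma gg_swap {A : Finset ℕ} (a b x y : ℕ) : gg A a b y x = - gg A a b x y := by
  unfold gg
  rw [← Finset.sum_neg_distrib]
  exact Finset.sum_congr rfl fun r _ => by rw [sgn_swap]; ring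

lemma gg_other {A : Finset ℕ} {a b x y : ℕ} (ha : a ∈ A) (hb : b ∈ A) (hx : x ∈ A)
    (hy : y ∈ A) (hxy : x ≠ y) (h1 : ¬ (a = x ∧ b = y)) (h2 : ¬ (a = y ∧ b = x)) :
    gg A b a x y = gg A a b x y := by
  have hσ := swap_bij ha hb
  unfold gg
  rw [← sum_mapOrder hσ]
  refine Finset.sum_congr rfl fun r hr => ?_
  have hr' := (mem_linOrders.1 hr).1
  have e1 : tp A (mapOrder (Equiv.swap a b) r) b a = tp A r a b := by
    have := tp_mapOrder hσ hr ha hb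
    rwa [Equiv.swap_apply_left, Equiv.swap_apply_right] at this
  have e2 : sgn (mapOrder (Equiv.swap a b) r) x y
      = sgn r (Equiv.swap a b x) (Equiv.swap a b y) := by
    have := sgn_mapOrder hσ hr' (bij_mem hσ hx) (bij_mem hσ hy)
    rwa [Equiv.swap_apply_self, Equiv.swap_apply_self] at this
  rw [e1, e2]
  unfold tp
  split_ifs with hT
  swap
  · ring
  obtain ⟨hab, hTab, hTz⟩ := hT
  have htr := (mem_linOrders.1 hr).2.2.2.1
  have pb : ∀ z ∈ A, z ≠ a → z ≠ b → sgn r b z = 1 := fun z hz za zb =>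
    sgn_one hr (hTz z hz za zb) zb.symm
  have pa : ∀ z ∈ A, z ≠ a → z ≠ b → sgn r a z = 1 := fun z hz za zb =>
    sgn_one hr (htr _ _ _ hTab (hTz z hz za zb)) za.symm
  congr 1
  by_cases xa : x = a
  · subst xa
    have yb : y ≠ b := fun h => h1 ⟨rfl, h.symm⟩
    rw [Equiv.swap_apply_left, Equiv.swap_apply_of_ne_of_ne hxy.symm yb,
      pb y hy hxy.symm yb, pa y hy hxy.symm yb]
  by_cases xb : x = b
  · subst xb
    have ya : y ≠ a := fun h => h2 ⟨h.symm, rfl⟩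
    rw [Equiv.swap_apply_right, Equiv.swap_apply_of_ne_of_ne ya hxy.symm,
      pb y hy ya hxy.symm, pa y hy ya hxy.symm]
  rw [Equiv.swap_apply_of_ne_of_ne xa xb]
  by_cases ya : y = a
  · subst ya
    rw [Equiv.swap_apply_left, sgn_swap, pb x hx xa xb, sgn_swap, pa x hx xa xb]
  by_cases yb : y = b
  · subst yb
    rw [Equiv.swap_apply_right, sgn_swap, pa x hx xa xb, sgn_swap, pb x hx xa xb]
  rw [Equiv.swap_apply_of_ne_of_ne ya yb]

noncomputable def wt (A : Finset ℕ) (M : ℕ → ℕ → ℚ) (r : Finset (ℕ × ℕ)) : ℚ :=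
  ∑ a ∈ A, ∑ b ∈ A, M a b / cnt A a b * tp A r a b

lemma sum_bij_A {A : Finset ℕ} {π : ℕ → ℕ} (hπ : Set.BijOn π (A : Set ℕ) (A : Set ℕ))
    (F : ℕ → ℚ) : ∑ a ∈ A, F (π a) = ∑ a ∈ A, F a :=
  Finset.sum_nbij π (fun _ h => bij_mem hπ h) hπ.injOn hπ.surjOn (fun _ _ => rfl)

lemma wt_map {A : Finset ℕ} {M : ℕ → ℕ → ℚ} {π : ℕ → ℕ}
    (hπ : Set.BijOn π (A : Set ℕ) (A : Set ℕ))
    (hM : ∀ x ∈ A, ∀ y ∈ A, M x y = M (π x) (π y)) {r : Finset (ℕ × ℕ)}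
    (hr : r ∈ linOrders A) : wt A M (mapOrder π r) = wt A M r := by
  unfold wt
  rw [← sum_bij_A hπ]
  refine Finset.sum_congr rfl fun a ha => ?_
  rw [← sum_bij_A hπ]
  refine Finset.sum_congr rfl fun b hb => ?_
  rw [← hM a ha b hb, cnt_map hπ ha hb, tp_mapOrder hπ hr ha hb]

lemma wt_margin {A : Finset ℕ} {M : ℕ → ℕ → ℚ}
    (hskew : ∀ x ∈ A, ∀ y ∈ A, M x y = - M y x) {x y : ℕ} (hx : x ∈ A) (hy : y ∈ A)
    (hxy : x ≠ y) : ∑ r ∈ linOrders A, wt A M r * sgn r x y = 2 * M x y := by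
  have e1 : ∑ r ∈ linOrders A, wt A M r * sgn r x y
      = ∑ a ∈ A, ∑ b ∈ A, M a b / cnt A a b * gg A a b x y := by
    unfold wt gg
    simp_rw [Finset.sum_mul, Finset.mul_sum]
    rw [Finset.sum_comm]
    refine Finset.sum_congr rfl fun a _ => ?_
    rw [Finset.sum_comm]
    refine Finset.sum_congr rfl fun b _ => Finset.sum_congr rfl fun r _ => ?_
    ring
  have e2 : ∑ a ∈ A, ∑ b ∈ A, M a b / cnt A a b * gg A a b x y
      = ∑ a ∈ A, ∑ b ∈ A, M b a / cnt A b a * gg A b a x y := Finset.sum_comm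
  have e3 : ∑ a ∈ A, ∑ b ∈ A, M a b / cnt A a b * gg A a b x y
      + ∑ a ∈ A, ∑ b ∈ A, M b a / cnt A b a * gg A b a x y
      = ∑ a ∈ A, ∑ b ∈ A, ((if a = x then (if b = y then 2 * M x y else 0) else 0)
        + (if a = y then (if b = x then 2 * M x y else 0) else 0)) := by
    rw [← Finset.sum_add_distrib]
    refine Finset.sum_congr rfl fun a ha => ?_
    rw [← Finset.sum_add_distrib]
    refine Finset.sum_congr rfl fun b hb => ?_
    rw [hskew b hb a ha, cnt_symm ha hb]
    have hp := (cnt_pos hx hy hxy).ne'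
    by_cases h1 : a = x ∧ b = y
    · obtain ⟨rfl, rfl⟩ := h1
      rw [gg_self, gg_swap, gg_self, cnt_symm ha hb]
      simp only [hxy, if_true, if_false]
      field_simp
      ring
    by_cases h2 : a = y ∧ b = x
    · obtain ⟨rfl, rfl⟩ := h2
      rw [gg_self, gg_swap, gg_self, cnt_symm hb ha, hskew a ha b hb]
      simp only [hxy, hxy.symm, if_true, if_false]
      field_simp
      ring
    rw [gg_other ha hb hx hy hxy h1 h2, ← ite_and, ← ite_and, if_neg h1, if_neg h2]
    ring
  have e4 : ∑ a ∈ A, ∑ b ∈ A, ((if a = x then (if b = y then 2 * M x y else 0) else 0)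
        + (if a = y then (if b = x then 2 * M x y else 0) else 0)) = 4 * M x y := by
    simp_rw [Finset.sum_add_distrib]
    have : ∀ u ∈ A, ∀ v ∈ A, ∑ a ∈ A, ∑ b ∈ A,
        (if a = u then (if b = v then 2 * M x y else 0) else 0) = 2 * M x y := by
      intro u hu v hv
      rw [Finset.sum_eq_single u, Finset.sum_eq_single v]
      · simp
      · intro b _ h; simp [h]
      · intro h; exact absurd hv h
      · intro a _ h; simp [h]
      · intro h; exact absurd hu h
    rw [this x hx y hy, this y hy x hx]; ring
  linarith

lemma sgn_sum {A : Finset ℕ} {x y : ℕ} (hx : x ∈ A) (hy : y ∈ A) :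
    ∑ r ∈ linOrders A, sgn r x y = 0 := by
  have hσ := swap_bij hx hy
  have h : ∑ r ∈ linOrders A, sgn r x y = ∑ r ∈ linOrders A, - sgn r x y := by
    rw [← sum_mapOrder hσ]
    refine Finset.sum_congr rfl fun r hr => ?_
    have := sgn_mapOrder hσ (mem_linOrders.1 hr).1 hy hx
    rw [Equiv.swap_apply_left, Equiv.swap_apply_right] at this
    rw [this, sgn_swap]
  rw [Finset.sum_neg_distrib] at h
  linarith

end Aux

/-- McGarvey's theorem for fractional profiles: every skew-symmetric rational matrix is a
positive multiple of the majority-margin matrix of some profile, which can moreover be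
chosen invariant under every symmetry of the matrix. -/
theorem mcgarvey (n : ℕ) (hn : 0 < n) (M : ℕ → ℕ → ℚ)
    (hskew : ∀ x ∈ Finset.range n, ∀ y ∈ Finset.range n, M x y = - M y x) :
    ∃ R : Finset (ℕ × ℕ) → ℚ, ∃ c : ℚ, IsProfile (Finset.range n) R ∧ 0 < c ∧
      (∀ x ∈ Finset.range n, ∀ y ∈ Finset.range n,
        c * M x y = margin (Finset.range n) R x y) ∧
      ∀ pi : ℕ → ℕ, Set.BijOn pi ↑(Finset.range n) ↑(Finset.range n) →
        (∀ x ∈ Finset.range n, ∀ y ∈ Finset.range n, M x y = M (pi x) (pi y)) →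
        mapProfile pi (Finset.range n) R = R := by
  classical
  generalize Finset.range n = A at *
  set B : ℚ := 1 + ∑ r ∈ linOrders A, |wt A M r| with hB
  have hpos : ∀ r ∈ linOrders A, 0 < B + wt A M r := by
    intro r hr
    have h1 : |wt A M r| ≤ ∑ r ∈ linOrders A, |wt A M r| :=
      Finset.single_le_sum (f := fun r => |wt A M r|) (fun _ _ => abs_nonneg _) hr
    have h2 := neg_abs_le (wt A M r)
    linarith
  set S : ℚ := ∑ r ∈ linOrders A, (B + wt A M r) with hS
  have hSpos : 0 < S :=
    Finset.sum_pos hpos ⟨_, order_of_key A id Function.injective_id⟩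
  refine ⟨fun r => if r ∈ linOrders A then (B + wt A M r) / S else 0, 2 / S,
    ⟨?_, ?_, ?_⟩, by positivity, ?_, ?_⟩
  · intro r hr; simp [hr]
  · intro r
    show 0 ≤ if r ∈ linOrders A then (B + wt A M r) / S else 0
    split_ifs with h
    · exact (div_pos (hpos r h) hSpos).le
    · exact le_rfl
  · rw [Finset.sum_congr rfl (fun r hr => if_pos hr), ← Finset.sum_div, ← hS]
    exact div_self hSpos.ne'
  · intro x hx y hy
    rw [margin_eq]
    have e : ∑ r ∈ linOrders A, (if r ∈ linOrders A then (B + wt A M r) / S else 0) * sgn r x y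
        = (B * ∑ r ∈ linOrders A, sgn r x y + ∑ r ∈ linOrders A, wt A M r * sgn r x y) / S := by
      rw [Finset.mul_sum, ← Finset.sum_add_distrib, Finset.sum_div]
      refine Finset.sum_congr rfl fun r hr => ?_
      rw [if_pos hr]; ring
    rw [e, sgn_sum hx hy]
    by_cases hxy : x = y
    · subst hxy
      have h0 : M x x = 0 := by linarith [hskew x hx x hx]
      have h1 : ∀ r, sgn r x x = 0 := fun r => by unfold sgn; ring
      simp [h0, h1]
    · rw [wt_margin hskew hx hy hxy]; ring
  · intro π hπ hM
    funext s
    unfold mapProfile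
    rw [Finset.sum_filter]
    set R : Finset (ℕ × ℕ) → ℚ := fun r => if r ∈ linOrders A then (B + wt A M r) / S else 0
      with hR
    have hinv : ∀ r ∈ linOrders A, R (mapOrder π r) = R r := by
      intro r hr
      simp only [hR]
      rw [if_pos hr, if_pos (mapOrder_mem hπ hr), wt_map hπ hM hr]
    have e : ∑ r ∈ linOrders A, (if mapOrder π r = s then R r else 0)
        = ∑ r ∈ linOrders A, (if r = s then R r else 0) := by
      rw [← sum_mapOrder hπ (fun r => if r = s then R r else 0)]
      refine Finset.sum_congr rfl fun r hr => ?_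
      rw [hinv r hr]
    rw [e, Finset.sum_ite_eq']
    split_ifs with h
    · simp only [hR, if_pos h]
    · rfl

end PSC
end

section
/- For every agenda A and every preference profile R on A, if x ∈ A is a strict Condorcet winner in R (i.e., M_R(x,y) > 0 for all y ∈ A∖{x}), then ML(R) is the singleton containing the degenerate lottery on x. -/
open Finset

namespace PSC

/-- If `x` is a strict Condorcet winner in `R`, then `ML(R)` is the singleton consisting
of the degenerate lottery on `x`. -/
theorem ml_strict_condorcet (A : Finset ℕ) (hA : A.Nonempty)
    (R : Finset (ℕ × ℕ) → ℚ) (hR : IsProfile A R) (x : ℕ) (hx : x ∈ A)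
    (hstrict : ∀ y ∈ A, y ≠ x → 0 < margin A R x y) :
    ML A R = {degLottery x} := by
  have hself : margin A R x x = 0 := sub_self _
  have hdeg : IsLottery A (degLottery x) := by
    refine ⟨fun z hz => ?_, fun z => ?_, ?_⟩
    · have : z ≠ x := fun h => hz (h ▸ hx)
      simp [degLottery, this]
    · unfold degLottery
      split_ifs <;> norm_num
    · simp [degLottery, hx]
  ext p
  simp only [ML, Set.mem_setOf_eq, Set.mem_singleton_iff]
  constructor
  · rintro ⟨⟨h0, hnn, hsum⟩, hp⟩
    have h1 := hp _ hdeg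
    have h2 : ∑ a ∈ A, ∑ y ∈ A, p a * margin A R a y * degLottery x y
        = - ∑ a ∈ A, p a * margin A R x a := by
      rw [← Finset.sum_neg_distrib]
      refine Finset.sum_congr rfl fun a _ => ?_
      simp only [degLottery, mul_ite, mul_one, mul_zero, Finset.sum_ite_eq', hx, if_true]
      unfold margin
      ring
    rw [h2] at h1
    have hterm : ∀ a ∈ A, 0 ≤ p a * margin A R x a := by
      intro a ha
      by_cases hax : a = x
      · subst hax
        simp [hself]
      · exact mul_nonneg (hnn a) (hstrict a ha hax).le
    have h3 : ∑ a ∈ A, p a * margin A R x a = 0 :=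
      le_antisymm (by linarith) (Finset.sum_nonneg hterm)
    have h4 := (Finset.sum_eq_zero_iff_of_nonneg hterm).1 h3
    have h5 : ∀ a, a ≠ x → p a = 0 := by
      intro a hax
      by_cases ha : a ∈ A
      · exact (mul_eq_zero.1 (h4 a ha)).resolve_right (hstrict a ha hax).ne'
      · exact h0 a ha
    have h6 : p x = 1 := by
      rw [← hsum]
      exact (Finset.sum_eq_single_of_mem x hx fun b _ hb => h5 b hb).symm
    funext a
    by_cases hax : a = x
    · simp [degLottery, hax, h6]
    · simp [degLottery, hax, h5 a hax]
  · rintro rfl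
    refine ⟨hdeg, fun q hq => ?_⟩
    rw [Finset.sum_eq_single_of_mem x hx]
    · refine Finset.sum_nonneg fun y hy => ?_
      by_cases hyx : y = x
      · subst hyx
        simp [hself]
      · have h1 := (hstrict y hy hyx).le
        have h2 := hq.2.1 y
        simpa [degLottery] using mul_nonneg h1 h2
    · intro b _ hb
      simp [degLottery, hb]

end PSC
end
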